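/- 𝔦 is a norm-closed two-sided ideal of the monotone C*-algebra 𝔐, and it is the only proper nonzero one: every norm-closed two-sided ideal of 𝔐 equals {0}, 𝔦, or 𝔐. -/

import Mathlib

noncomputable section

open ContinuousLinearMap
open scoped InnerProductSpace ComplexOrder

/-- The discrete monotone Fock space: `ℓ²` over the finite subsets of `ℤ`. -/
abbrev MF : Type := lp (fun _ : Finset ℤ => ℂ) 2

/-- The canonical orthonormal basis vector corresponding to a finite subset `S ⊆ ℤ`;
`eS ∅` is the vacuum vector `Ω`. -/
noncomputable def eS (S : Finset ℤ) : MF := lp.single 2 S 1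

/-- `a : ℤ → MF →L[ℂ] MF` is the family of monotone annihilation operators:
`a i (eS S) = eS (S \ {i})` if `S` is nonempty with `min S = i`, and `a i (eS S) = 0`
otherwise.  The creation operator `a_i†` is the Hilbert-space adjoint of `a i`. -/
def IsMonotoneAnnihilation (a : ℤ → MF →L[ℂ] MF) : Prop :=
  ∀ (i : ℤ) (S : Finset ℤ),
    (S.min = (i : WithBot ℤ) → a i (eS S) = eS (S.erase i)) ∧
    (S.min ≠ (i : WithBot ℤ) → a i (eS S) = 0)

/-- The monotone C*-algebra `𝔐`: the unital C*-subalgebra of `B(F)` generated by the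
annihilation operators. -/
noncomputable def MonM (a : ℤ → MF →L[ℂ] MF) : StarSubalgebra ℂ (MF →L[ℂ] MF) :=
  (StarAlgebra.adjoin ℂ (Set.range a)).topologicalClosure

/-- The non-unital monotone C*-algebra `𝔦`: the norm-closed star-subalgebra of `B(F)`
generated by the annihilation operators. -/
noncomputable def MonI (a : ℤ → MF →L[ℂ] MF) : NonUnitalStarSubalgebra ℂ (MF →L[ℂ] MF) :=
  (NonUnitalStarAlgebra.adjoin ℂ (Set.range a)).topologicalClosure

theorem inner_eS (S : Finset ℤ) (f : MF) : ⟪eS S, f⟫_ℂ = f S := by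
  simp [eS, lp.inner_single_left]

theorem inner_eS_eS (S T : Finset ℤ) : ⟪eS S, eS T⟫_ℂ = if S = T then 1 else 0 := by
  rw [inner_eS, eS, lp.single_apply]
  by_cases h : S = T
  · subst h
    simp
  · simp [h]

theorem ext_inner_eS {f g : MF} (h : ∀ S, ⟪eS S, f⟫_ℂ = ⟪eS S, g⟫_ℂ) : f = g := by
  ext S
  rw [← inner_eS, ← inner_eS, h]

/-- Bounded operators on the Fock space are determined by their values on the canonical basis. -/
theorem clm_ext_eS {A B : MF →L[ℂ] MF} (h : ∀ S, A (eS S) = B (eS S)) : A = B := by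
  ext1 f
  have hf := lp.hasSum_single (p := 2) (by norm_num) f
  have key : ∀ S : Finset ℤ, lp.single 2 S (f S) = f S • eS S := fun S => by
    rw [eS, ← lp.single_smul, smul_eq_mul, mul_one]
  simp only [key] at hf
  have hA := A.hasSum hf
  have hB := B.hasSum hf
  simp only [map_smul, h] at hA hB
  exact hA.unique hB

theorem norm_eS (S : Finset ℤ) : ‖eS S‖ = 1 := by
  have h := inner_self_eq_norm_sq_to_K (𝕜 := ℂ) (eS S)
  rw [inner_eS_eS, if_pos rfl] at h
  have h' : ‖eS S‖ ^ 2 = 1 := (Complex.ofReal_injective (by push_cast; exact h)).symm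
  nlinarith [norm_nonneg (eS S)]

theorem norm_inner_eS_le (A : MF →L[ℂ] MF) (S T : Finset ℤ) : ‖⟪eS S, A (eS T)⟫_ℂ‖ ≤ ‖A‖ := by
  refine (norm_inner_le_norm _ _).trans ?_
  simpa [norm_eS] using A.le_opNorm (eS T)

theorem inner_star_apply (A : MF →L[ℂ] MF) (f g : MF) : ⟪f, star A g⟫_ℂ = ⟪A f, g⟫_ℂ := by
  rw [ContinuousLinearMap.star_eq_adjoint, ContinuousLinearMap.adjoint_inner_right]

theorem min_eq_coe_iff (S : Finset ℤ) (i : ℤ) :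
    S.min = (i : WithBot ℤ) ↔ i ∈ S ∧ ∀ s ∈ S.erase i, i < s := by
  change S.min = (i : WithTop ℤ) ↔ _
  constructor
  · intro h
    refine ⟨Finset.mem_of_min h, fun s hs => ?_⟩
    have := Finset.min_le_of_eq (Finset.mem_of_mem_erase hs) h
    have := Finset.ne_of_mem_erase hs
    omega
  · rintro ⟨h, h'⟩
    refine le_antisymm (Finset.min_le h) (Finset.le_min fun s hs => ?_)
    rw [WithTop.coe_le_coe]
    by_cases hsi : s = i
    · exact hsi.ge
    · exact (h' s (Finset.mem_erase.2 ⟨hsi, hs⟩)).le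

theorem mem_MonM (a : ℤ → MF →L[ℂ] MF) (i : ℤ) : a i ∈ MonM a :=
  StarSubalgebra.le_topologicalClosure _ (StarAlgebra.subset_adjoin ℂ _ ⟨i, rfl⟩)

namespace IsMonotoneAnnihilation

variable {a : ℤ → MF →L[ℂ] MF} (ha : IsMonotoneAnnihilation a)
include ha

theorem apply_of_min {i : ℤ} {S : Finset ℤ} (hi : i ∈ S) (h : ∀ s ∈ S.erase i, i < s) :
    a i (eS S) = eS (S.erase i) :=
  (ha i S).1 ((min_eq_coe_iff S i).2 ⟨hi, h⟩)

theorem apply_of_not_min {i : ℤ} {S : Finset ℤ} (h : ¬ (i ∈ S ∧ ∀ s ∈ S.erase i, i < s)) :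
    a i (eS S) = 0 :=
  (ha i S).2 fun h' => h ((min_eq_coe_iff S i).1 h')

theorem apply_insert {i : ℤ} {S : Finset ℤ} (h : ∀ s ∈ S, i < s) :
    a i (eS (insert i S)) = eS S := by
  have hi : i ∉ S := fun hi => lt_irrefl i (h i hi)
  rw [ha.apply_of_min (Finset.mem_insert_self i S)] <;> rw [Finset.erase_insert hi]
  exact h

theorem star_apply_of_lt {i : ℤ} {S : Finset ℤ} (h : ∀ s ∈ S, i < s) :
    star (a i) (eS S) = eS (insert i S) := by
  have hi : i ∉ S := fun hi => lt_irrefl i (h i hi)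
  refine ext_inner_eS fun T => ?_
  rw [inner_star_apply]
  by_cases hT : i ∈ T ∧ ∀ s ∈ T.erase i, i < s
  · rw [ha.apply_of_min hT.1 hT.2, inner_eS_eS, inner_eS_eS]
    refine if_congr ⟨fun h' => ?_, fun h' => ?_⟩ rfl rfl
    · rw [← h', Finset.insert_erase hT.1]
    · rw [h', Finset.erase_insert hi]
  · rw [ha.apply_of_not_min hT, inner_zero_left, inner_eS_eS, if_neg]
    rintro rfl
    refine hT ⟨Finset.mem_insert_self i S, ?_⟩
    rwa [Finset.erase_insert hi]

theorem star_apply_of_not_lt {i : ℤ} {S : Finset ℤ} (h : ¬ ∀ s ∈ S, i < s) :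
    star (a i) (eS S) = 0 := by
  refine ext_inner_eS fun T => ?_
  rw [inner_star_apply, inner_zero_right]
  by_cases hT : i ∈ T ∧ ∀ s ∈ T.erase i, i < s
  · rw [ha.apply_of_min hT.1 hT.2, inner_eS_eS, if_neg]
    rintro rfl
    exact h hT.2
  · rw [ha.apply_of_not_min hT, inner_zero_left]

end IsMonotoneAnnihilation

/-- `W` prepends `S` to every finite set lying above `n`, and kills all other basis vectors. -/
def IsShift (n : ℤ) (S : Finset ℤ) (W : MF →L[ℂ] MF) : Prop :=
  ∀ U : Finset ℤ,
    ((∀ u ∈ U, n < u) → W (eS U) = eS (S ∪ U)) ∧ ((¬ ∀ u ∈ U, n < u) → W (eS U) = 0)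

theorem IsShift.unique {n : ℤ} {S : Finset ℤ} {W W' : MF →L[ℂ] MF}
    (h : IsShift n S W) (h' : IsShift n S W') : W = W' := by
  refine clm_ext_eS fun U => ?_
  by_cases hU : ∀ u ∈ U, n < u
  · rw [(h U).1 hU, (h' U).1 hU]
  · rw [(h U).2 hU, (h' U).2 hU]

theorem filter_union_eq {n : ℤ} {S U : Finset ℤ} (hS : ∀ s ∈ S, s ≤ n) (hU : ∀ u ∈ U, n < u) :
    (S ∪ U).filter (n < ·) = U ∧ (S ∪ U).filter (· ≤ n) = S := by
  constructor <;> ext x <;> simp only [Finset.mem_filter, Finset.mem_union] <;>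
    have := hS x <;> have := hU x <;> grind

theorem IsShift.star_mul_shift {n : ℤ} {S T : Finset ℤ} {V W Q : MF →L[ℂ] MF}
    (hS : ∀ s ∈ S, s ≤ n) (hT : ∀ s ∈ T, s ≤ n)
    (hV : IsShift n S V) (hW : IsShift n T W) (hQ : IsShift n ∅ Q) :
    star V * W = if S = T then Q else 0 := by
  refine clm_ext_eS fun U => ext_inner_eS fun R => ?_
  rw [mul_apply_eq_comp, inner_star_apply]
  by_cases hU : ∀ u ∈ U, n < u
  · rw [(hW U).1 hU]
    by_cases hR : ∀ u ∈ R, n < u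
    · rw [(hV R).1 hR, inner_eS_eS]
      have h1 := filter_union_eq hS hR
      have h2 := filter_union_eq hT hU
      by_cases hST : S = T
      · rw [if_pos hST, (hQ U).1 hU, Finset.empty_union, inner_eS_eS]
        refine if_congr ⟨fun h => ?_, fun h => by rw [hST, h]⟩ rfl rfl
        rw [← h1.1, h, h2.1]
      · rw [if_neg hST, if_neg, zero_apply, inner_zero_right]
        intro h
        exact hST (by rw [← h1.2, h, h2.2])
    · rw [(hV R).2 hR, inner_zero_left]
      split_ifs
      · rw [(hQ U).1 hU, Finset.empty_union, inner_eS_eS, if_neg]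
        rintro rfl
        exact hR hU
      · rw [zero_apply, inner_zero_right]
  · rw [(hW U).2 hU, inner_zero_right]
    split_ifs
    · rw [(hQ U).2 hU, inner_zero_right]
    · rw [zero_apply, inner_zero_right]

theorem IsShift.mul_empty {n : ℤ} {S : Finset ℤ} {W Q : MF →L[ℂ] MF}
    (hW : IsShift n S W) (hQ : IsShift n ∅ Q) : W * Q = W := by
  refine clm_ext_eS fun U => ?_
  rw [mul_apply_eq_comp]
  by_cases hU : ∀ u ∈ U, n < u
  · rw [(hQ U).1 hU, Finset.empty_union]
  · rw [(hQ U).2 hU, (hW U).2 hU, map_zero]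

theorem IsShift.star_mul_self {n : ℤ} {S : Finset ℤ} {W Q : MF →L[ℂ] MF}
    (hS : ∀ s ∈ S, s ≤ n) (hW : IsShift n S W) (hQ : IsShift n ∅ Q) : star W * W = Q := by
  rw [hW.star_mul_shift hS hS hW hQ, if_pos rfl]

theorem IsShift.star_empty {n : ℤ} {Q : MF →L[ℂ] MF} (hQ : IsShift n ∅ Q) : star Q = Q := by
  have h := hQ.star_mul_self (by simp) hQ
  calc star Q = star (star Q * Q) := by rw [h]
    _ = star Q * Q := by rw [star_mul, star_star]
    _ = Q := h

theorem IsShift.norm_le_one {n : ℤ} {S : Finset ℤ} {W Q : MF →L[ℂ] MF}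
    (hS : ∀ s ∈ S, s ≤ n) (hW : IsShift n S W) (hQ : IsShift n ∅ Q) : ‖W‖ ≤ 1 := by
  have h1 : ‖Q‖ = ‖Q‖ * ‖Q‖ := by
    rw [← CStarRing.norm_star_mul_self, hQ.star_mul_self (by simp) hQ]
  have h2 : ‖Q‖ = ‖W‖ * ‖W‖ := by
    rw [← CStarRing.norm_star_mul_self, hW.star_mul_self hS hQ]
  have h3 : ‖Q‖ ≤ 1 := by nlinarith [norm_nonneg Q]
  nlinarith [norm_nonneg W]

namespace IsMonotoneAnnihilation

variable {a : ℤ → MF →L[ℂ] MF} (ha : IsMonotoneAnnihilation a)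
include ha

theorem isShift_empty (n : ℤ) : IsShift n ∅ (a n * star (a n)) := by
  refine fun U => ⟨fun hU => ?_, fun hU => ?_⟩ <;> rw [mul_apply_eq_comp]
  · rw [ha.star_apply_of_lt hU, ha.apply_insert hU, Finset.empty_union]
  · rw [ha.star_apply_of_not_lt hU, map_zero]

theorem isShift_star_mul {n i : ℤ} {S : Finset ℤ} {W : MF →L[ℂ] MF} (hi : i ≤ n)
    (h : ∀ s ∈ S, i < s) (hW : IsShift n S W) : IsShift n (insert i S) (star (a i) * W) := by
  refine fun U => ⟨fun hU => ?_, fun hU => ?_⟩ <;> rw [mul_apply_eq_comp]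
  · rw [(hW U).1 hU, ha.star_apply_of_lt, Finset.insert_union]
    intro s hs
    rcases Finset.mem_union.1 hs with hs | hs
    · exact h s hs
    · exact hi.trans_lt (hU s hs)
  · rw [(hW U).2 hU, map_zero]

theorem star_mul_shift_eq_zero {n i : ℤ} {S : Finset ℤ} {W : MF →L[ℂ] MF}
    (h : ¬ ∀ s ∈ S, i < s) (hW : IsShift n S W) : star (a i) * W = 0 := by
  refine clm_ext_eS fun U => ?_
  rw [mul_apply_eq_comp, zero_apply]
  by_cases hU : ∀ u ∈ U, n < u
  · rw [(hW U).1 hU, ha.star_apply_of_not_lt]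
    exact fun h' => h fun s hs => h' s (Finset.mem_union_left _ hs)
  · rw [(hW U).2 hU, map_zero]

theorem isShift_mul {n i : ℤ} {S : Finset ℤ} {W : MF →L[ℂ] MF} (hi : i ≤ n)
    (h : i ∈ S ∧ ∀ s ∈ S.erase i, i < s) (hW : IsShift n S W) :
    IsShift n (S.erase i) (a i * W) := by
  refine fun U => ⟨fun hU => ?_, fun hU => ?_⟩ <;> rw [mul_apply_eq_comp]
  · have hiU : i ∉ U := fun h' => (hU i h').not_ge hi
    have e : (S ∪ U).erase i = S.erase i ∪ U := by
      rw [Finset.erase_union_distrib, Finset.erase_eq_of_notMem hiU]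
    rw [(hW U).1 hU, ha.apply_of_min (Finset.mem_union_left _ h.1), e]
    rw [e]
    intro s hs
    rcases Finset.mem_union.1 hs with hs | hs
    · exact h.2 s hs
    · exact hi.trans_lt (hU s hs)
  · rw [(hW U).2 hU, map_zero]

theorem mul_shift_eq_zero {n i : ℤ} {S : Finset ℤ} {W : MF →L[ℂ] MF} (hi : i ≤ n)
    (h : ¬ (i ∈ S ∧ ∀ s ∈ S.erase i, i < s)) (hW : IsShift n S W) : a i * W = 0 := by
  refine clm_ext_eS fun U => ?_
  rw [mul_apply_eq_comp, zero_apply]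
  by_cases hU : ∀ u ∈ U, n < u
  · rw [(hW U).1 hU, ha.apply_of_not_min]
    rintro ⟨h1, h2⟩
    have hiU : i ∉ U := fun h' => (hU i h').not_ge hi
    refine h ⟨(Finset.mem_union.1 h1).resolve_right hiU, fun s hs => h2 s ?_⟩
    exact Finset.erase_subset_erase i Finset.subset_union_left hs
  · rw [(hW U).2 hU, map_zero]

theorem exists_isShift (n : ℤ) (S : Finset ℤ) :
    (∀ s ∈ S, s ≤ n) → ∃ W ∈ MonM a, IsShift n S W := by
  induction S using Finset.induction_on_min with
  | empty =>
    exact fun _ => ⟨_, mul_mem (mem_MonM a n) (star_mem (mem_MonM a n)), ha.isShift_empty n⟩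
  | insert i S hi ih =>
    intro hS
    obtain ⟨W, hW, hW'⟩ := ih fun s hs => hS s (Finset.mem_insert_of_mem hs)
    exact ⟨_, mul_mem (star_mem (mem_MonM a i)) hW,
      ha.isShift_star_mul (hS i (Finset.mem_insert_self i S)) hi hW'⟩

end IsMonotoneAnnihilation

/-- The span of the operators prepending to the sets above `n` some finite set below `n`. -/
def shiftSpan (n : ℤ) : Submodule ℂ (MF →L[ℂ] MF) :=
  Submodule.span ℂ {W | ∃ S : Finset ℤ, (∀ s ∈ S, s ≤ n) ∧ IsShift n S W}

theorem mul_mem_shiftSpan {n : ℤ} {A : MF →L[ℂ] MF}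
    (h : ∀ S W, (∀ s ∈ S, s ≤ n) → IsShift n S W → A * W ∈ shiftSpan n)
    {K : MF →L[ℂ] MF} (hK : K ∈ shiftSpan n) : A * K ∈ shiftSpan n := by
  induction hK using Submodule.span_induction with
  | mem W hW =>
    obtain ⟨S, hS, hW⟩ := hW
    exact h S W hS hW
  | zero => rw [mul_zero]; exact zero_mem _
  | add x y _ _ hx hy => rw [mul_add]; exact add_mem hx hy
  | smul c x _ hx => rw [mul_smul_comm]; exact Submodule.smul_mem _ c hx

theorem star_mul_shiftSpan {n : ℤ} {S : Finset ℤ} {V Q : MF →L[ℂ] MF} (hS : ∀ s ∈ S, s ≤ n)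
    (hV : IsShift n S V) (hQ : IsShift n ∅ Q) {K : MF →L[ℂ] MF} (hK : K ∈ shiftSpan n) :
    ∃ c : ℂ, star V * K = c • Q := by
  induction hK using Submodule.span_induction with
  | mem W hW =>
    obtain ⟨T, hT, hW⟩ := hW
    rw [hV.star_mul_shift hS hT hW hQ]
    split_ifs
    · exact ⟨1, (one_smul _ _).symm⟩
    · exact ⟨0, (zero_smul _ _).symm⟩
  | zero => exact ⟨0, by rw [mul_zero, zero_smul]⟩
  | add x y _ _ hx hy =>
    obtain ⟨c, hc⟩ := hx
    obtain ⟨d, hd⟩ := hy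
    exact ⟨c + d, by rw [mul_add, hc, hd, add_smul]⟩
  | smul c x _ hx =>
    obtain ⟨d, hd⟩ := hx
    exact ⟨c * d, by rw [mul_smul_comm, hd, mul_smul]⟩

namespace IsMonotoneAnnihilation

variable {a : ℤ → MF →L[ℂ] MF} (ha : IsMonotoneAnnihilation a)
include ha

theorem exists_mul_mem_shiftSpan {Y : MF →L[ℂ] MF}
    (hY : Y ∈ StarAlgebra.adjoin ℂ (Set.range a)) :
    ∃ N, ∀ n ≥ N, ∀ K ∈ shiftSpan n, Y * K ∈ shiftSpan n := by
  rw [← StarSubalgebra.mem_toSubalgebra, StarAlgebra.adjoin_toSubalgebra] at hY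
  induction hY using Algebra.adjoin_induction with
  | mem x hx =>
    rcases hx with ⟨i, rfl⟩ | ⟨i, hi⟩
    · refine ⟨i, fun n hn K hK => mul_mem_shiftSpan (fun S W hS hW => ?_) hK⟩
      by_cases h : i ∈ S ∧ ∀ s ∈ S.erase i, i < s
      · exact Submodule.subset_span
          ⟨_, fun s hs => hS s (Finset.mem_of_mem_erase hs), ha.isShift_mul hn h hW⟩
      · rw [ha.mul_shift_eq_zero hn h hW]
        exact zero_mem _
    · obtain rfl : star (a i) = x := by rw [hi, star_star]
      refine ⟨i, fun n hn K hK => mul_mem_shiftSpan (fun S W hS hW => ?_) hK⟩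
      by_cases h : ∀ s ∈ S, i < s
      · exact Submodule.subset_span
          ⟨_, (Finset.forall_mem_insert _ _ _).2 ⟨hn, hS⟩, ha.isShift_star_mul hn h hW⟩
      · rw [ha.star_mul_shift_eq_zero h hW]
        exact zero_mem _
  | algebraMap r =>
    refine ⟨0, fun n _ K hK => ?_⟩
    rw [← Algebra.smul_def]
    exact Submodule.smul_mem _ r hK
  | add x y _ _ hx hy =>
    obtain ⟨N, hN⟩ := hx
    obtain ⟨M, hM⟩ := hy
    refine ⟨max N M, fun n hn K hK => ?_⟩
    rw [add_mul]
    exact add_mem (hN n ((le_max_left _ _).trans hn) K hK)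
      (hM n ((le_max_right _ _).trans hn) K hK)
  | mul x y _ _ hx hy =>
    obtain ⟨N, hN⟩ := hx
    obtain ⟨M, hM⟩ := hy
    refine ⟨max N M, fun n hn K hK => ?_⟩
    rw [mul_assoc]
    exact hN n ((le_max_left _ _).trans hn) _ (hM n ((le_max_right _ _).trans hn) K hK)

/-- Some two-sided multiple of a nonzero element of `𝔐` is close to some `a n * star (a n)`. -/
theorem exists_norm_sub_lt_one {x : MF →L[ℂ] MF} (hx : x ∈ MonM a) (hx0 : x ≠ 0) :
    ∃ n, ∃ V ∈ MonM a, ∃ W ∈ MonM a, a n * star (a n) * V = V ∧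
      ‖a n * star (a n) - V * x * W‖ < 1 := by
  obtain ⟨S, T, hc⟩ : ∃ S T, ⟪eS S, x (eS T)⟫_ℂ ≠ 0 := by
    by_contra! h
    exact hx0 (clm_ext_eS fun T => ext_inner_eS fun S => by rw [h S T]; simp)
  set c := ⟪eS S, x (eS T)⟫_ℂ with hcdef
  have hc' : 0 < ‖c‖ := norm_pos_iff.2 hc
  obtain ⟨Y, hY, hxY⟩ := Metric.mem_closure_iff.1 hx (‖c‖ / 3) (by positivity)
  rw [dist_eq_norm] at hxY
  obtain ⟨N, hN⟩ := ha.exists_mul_mem_shiftSpan hY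
  obtain ⟨m, hm⟩ := (S ∪ T).exists_le
  set n := max N m
  have hS : ∀ s ∈ S, s ≤ n := fun s hs =>
    (hm s (Finset.mem_union_left _ hs)).trans (le_max_right _ _)
  have hT : ∀ s ∈ T, s ≤ n := fun s hs =>
    (hm s (Finset.mem_union_right _ hs)).trans (le_max_right _ _)
  have hQ := ha.isShift_empty n
  obtain ⟨V, hV, hVS⟩ := ha.exists_isShift n S hS
  obtain ⟨W, hW, hWT⟩ := ha.exists_isShift n T hT
  obtain ⟨l, hl⟩ := star_mul_shiftSpan hS hVS hQ
    (hN n (le_max_left _ _) W (Submodule.subset_span ⟨T, hT, hWT⟩))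
  have hYl : ⟪eS S, Y (eS T)⟫_ℂ = l := by
    have h := congrArg (fun A : MF →L[ℂ] MF => ⟪eS ∅, A (eS ∅)⟫_ℂ) hl
    simp only [mul_apply_eq_comp, inner_star_apply] at h
    rw [(hVS ∅).1 (by simp), (hWT ∅).1 (by simp), Finset.union_empty, Finset.union_empty] at h
    rw [h, smul_apply, (hQ ∅).1 (by simp), inner_smul_right,
      Finset.empty_union, inner_eS_eS, if_pos rfl, mul_one]
  have hcl : ‖c - l‖ < ‖c‖ / 3 := by
    have h := norm_inner_eS_le (x - Y) S T
    rw [sub_apply, inner_sub_right, hYl] at h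
    exact h.trans_lt hxY
  have hl' : 2 * ‖c‖ / 3 < ‖l‖ := by
    have := norm_sub_norm_le c l
    linarith
  have hl0 : l ≠ 0 := norm_pos_iff.1 (by linarith)
  refine ⟨n, l⁻¹ • star V, SMulMemClass.smul_mem _ (star_mem hV), W, hW, ?_, ?_⟩
  · rw [mul_smul_comm]
    congr 1
    conv_rhs => rw [← hVS.mul_empty hQ]
    rw [star_mul, hQ.star_empty]
  · have e : a n * star (a n) - l⁻¹ • star V * x * W = l⁻¹ • (star V * (Y - x) * W) := by
      rw [mul_sub, sub_mul, mul_assoc _ Y, hl, smul_sub, smul_smul, inv_mul_cancel₀ hl0, one_smul,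
        smul_mul_assoc, smul_mul_assoc]
    have hb : ‖star V * (Y - x) * W‖ ≤ ‖c‖ / 3 := by
      calc ‖star V * (Y - x) * W‖ ≤ ‖star V‖ * ‖Y - x‖ * ‖W‖ :=
            (norm_mul_le _ _).trans (by gcongr; exact norm_mul_le _ _)
        _ ≤ 1 * (‖c‖ / 3) * 1 := by
            have hsV : ‖star V‖ = ‖V‖ := norm_star V
            rw [hsV, norm_sub_rev]
            gcongr
            · exact hVS.norm_le_one hS hQ
            · exact hWT.norm_le_one hT hQ
        _ = ‖c‖ / 3 := by ring
    rw [e, norm_smul, norm_inv, inv_mul_lt_one₀ (norm_pos_iff.2 hl0)]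
    linarith

theorem mul_star_mul_self (n : ℤ) : a n * star (a n) * a n = a n := by
  refine clm_ext_eS fun S => ?_
  simp only [mul_apply_eq_comp]
  by_cases h : n ∈ S ∧ ∀ s ∈ S.erase n, n < s
  · rw [ha.apply_of_min h.1 h.2, ha.star_apply_of_lt h.2, ha.apply_insert h.2]
  · rw [ha.apply_of_not_min h, map_zero, map_zero]

theorem mul_star_pred (n : ℤ) :
    a (n - 1) * star (a (n - 1)) = a n * star (a n) + star (a n) * a n := by
  refine clm_ext_eS fun S => ?_
  rw [add_apply, mul_apply_eq_comp (star (a n))]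
  have h1 := ha.isShift_empty (n - 1) S
  have h2 := ha.isShift_empty n S
  rw [Finset.empty_union] at h1 h2
  by_cases h : n ∈ S ∧ ∀ s ∈ S.erase n, n < s
  · rw [ha.apply_of_min h.1 h.2, ha.star_apply_of_lt h.2, Finset.insert_erase h.1,
      h2.2 fun h' => lt_irrefl n (h' n h.1), zero_add, h1.1]
    intro s hs
    by_cases hsn : s = n
    · omega
    · have := h.2 s (Finset.mem_erase.2 ⟨hsn, hs⟩)
      omega
  · rw [ha.apply_of_not_min h, map_zero, add_zero]
    by_cases hS : ∀ s ∈ S, n < s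
    · rw [h2.1 hS, h1.1 fun s hs => by have := hS s hs; omega]
    · rw [h2.2 hS, h1.2]
      intro h'
      by_cases hn : n ∈ S
      · refine h ⟨hn, fun s hs => ?_⟩
        have := h' s (Finset.mem_of_mem_erase hs)
        have := Finset.ne_of_mem_erase hs
        omega
      · refine hS fun s hs => ?_
        have := h' s hs
        have : s ≠ n := fun e => hn (e ▸ hs)
        omega

theorem mul_mul_star_of_lt {n k : ℤ} (hnk : n < k) : a k * (a n * star (a n)) = a k := by
  refine clm_ext_eS fun S => ?_
  rw [mul_apply_eq_comp]
  have h2 := ha.isShift_empty n S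
  rw [Finset.empty_union] at h2
  by_cases hS : ∀ s ∈ S, n < s
  · rw [h2.1 hS]
  · rw [h2.2 hS, map_zero, ha.apply_of_not_min]
    rintro ⟨h, h'⟩
    refine hS fun s hs => ?_
    by_cases hsk : s = k
    · omega
    · exact hnk.trans (h' s (Finset.mem_erase.2 ⟨hsk, hs⟩))

end IsMonotoneAnnihilation

theorem MonI_subset_MonM (a : ℤ → MF →L[ℂ] MF) {x : MF →L[ℂ] MF} (hx : x ∈ MonI a) :
    x ∈ MonM a := by
  have h : NonUnitalStarAlgebra.adjoin ℂ (Set.range a) ≤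
      (StarAlgebra.adjoin ℂ (Set.range a)).toNonUnitalStarSubalgebra :=
    NonUnitalStarAlgebra.adjoin_le (StarAlgebra.subset_adjoin ℂ _)
  exact closure_mono (fun y hy => h hy) hx

theorem exists_MonI_add_algebraMap (a : ℤ → MF →L[ℂ] MF) {x : MF →L[ℂ] MF} (hx : x ∈ MonM a) :
    ∃ y ∈ MonI a, ∃ c : ℂ, x = y + c • 1 := by
  set P : Submodule ℂ (MF →L[ℂ] MF) :=
    (MonI a).toNonUnitalSubalgebra.toSubmodule ⊔ ℂ ∙ (1 : MF →L[ℂ] MF) with hP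
  have hPmem : ∀ z, z ∈ P ↔ ∃ y ∈ MonI a, ∃ c : ℂ, z = y + c • 1 := by
    intro z
    simp only [hP, Submodule.mem_sup, Submodule.mem_span_singleton]
    constructor
    · rintro ⟨y, hy, _, ⟨c, rfl⟩, rfl⟩
      exact ⟨y, hy, c, rfl⟩
    · rintro ⟨y, hy, c, rfl⟩
      exact ⟨y, hy, _, ⟨c, rfl⟩, rfl⟩
  have hclosed : IsClosed (P : Set (MF →L[ℂ] MF)) :=
    Submodule.isClosed_sup_finiteDimensional _ _
      (NonUnitalStarSubalgebra.isClosed_topologicalClosure _)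
  rw [← hPmem]
  refine closure_minimal (fun z hz => ?_) hclosed hx
  have hz' : z ∈ StarAlgebra.adjoin ℂ (Set.range a) := hz
  rw [← StarSubalgebra.mem_toSubalgebra, StarAlgebra.adjoin_toSubalgebra] at hz'
  have hgen : ∀ i, a i ∈ MonI a := fun i =>
    NonUnitalStarSubalgebra.le_topologicalClosure _
      (NonUnitalStarAlgebra.subset_adjoin ℂ _ ⟨i, rfl⟩)
  clear hz
  change z ∈ P
  induction hz' using Algebra.adjoin_induction with
  | mem x hx =>
    refine (hPmem x).2 ⟨x, ?_, 0, by rw [zero_smul, add_zero]⟩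
    rcases hx with ⟨i, rfl⟩ | ⟨i, hi⟩
    · exact hgen i
    · rw [← star_star x, ← hi]
      exact star_mem (hgen i)
  | algebraMap r =>
    exact (hPmem _).2 ⟨0, zero_mem _, r, by rw [zero_add, Algebra.algebraMap_eq_smul_one]⟩
  | add x y _ _ hx hy => exact add_mem hx hy
  | mul x y _ _ hx hy =>
    obtain ⟨x', hx', c, rfl⟩ := (hPmem x).1 hx
    obtain ⟨y', hy', d, rfl⟩ := (hPmem y).1 hy
    refine (hPmem _).2 ⟨x' * y' + d • x' + c • y', add_mem (add_mem (mul_mem hx' hy')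
      (SMulMemClass.smul_mem _ hx')) (SMulMemClass.smul_mem _ hy'), d * c, ?_⟩
    simp only [add_mul, mul_add, smul_mul_assoc, mul_smul_comm, mul_one, one_mul, smul_add,
      smul_smul]
    abel

namespace IsMonotoneAnnihilation

variable {a : ℤ → MF →L[ℂ] MF} (ha : IsMonotoneAnnihilation a)
include ha

theorem exists_mul_star_mem {I : TwoSidedIdeal ↥(MonM a)} (hI : I ≠ ⊥) :
    ∃ n, (⟨a n, mem_MonM a n⟩ * star ⟨a n, mem_MonM a n⟩ : ↥(MonM a)) ∈ I := by
  obtain ⟨x, hxI, hx0⟩ : ∃ x ∈ I, x ≠ 0 := by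
    by_contra! h
    exact hI (le_bot_iff.1 fun x hx => (TwoSidedIdeal.mem_bot _).2 (h x hx))
  obtain ⟨n, V, hV, W, hW, hQV, hlt⟩ :=
    ha.exists_norm_sub_lt_one x.2 (fun h => hx0 (Subtype.ext h))
  refine ⟨n, ?_⟩
  have hidem : a n * star (a n) * (a n * star (a n)) = a n * star (a n) := by
    rw [← mul_assoc, ha.mul_star_mul_self]
  set q : ↥(MonM a) := ⟨a n, mem_MonM a n⟩ * star ⟨a n, mem_MonM a n⟩
  set z : ↥(MonM a) := ⟨V, hV⟩ * x * ⟨W, hW⟩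
  have hz : z ∈ I := I.mul_mem_right _ _ (I.mul_mem_left _ _ hxI)
  have hqz : q * z = z := by
    refine Subtype.ext ?_
    change a n * star (a n) * (V * x * W) = V * x * W
    rw [← mul_assoc, ← mul_assoc, hQV]
  have hqq : q * q = q := Subtype.ext hidem
  have hqz1 : ‖q - z‖ < 1 := hlt
  have : CompleteSpace ↥(MonM a) :=
    (StarSubalgebra.isClosed_topologicalClosure _).completeSpace_coe
  obtain ⟨u, hu⟩ := isUnit_one_sub_of_norm_lt_one hqz1
  have key : q = z * ↑u⁻¹ := by
    rw [Units.eq_mul_inv_iff_mul_eq, hu, mul_sub, mul_sub, hqz, hqq, mul_one]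
    abel
  rw [key]
  exact I.mul_mem_right _ _ hz

theorem generator_mem {I : TwoSidedIdeal ↥(MonM a)} (hI : I ≠ ⊥) (k : ℤ) :
    (⟨a k, mem_MonM a k⟩ : ↥(MonM a)) ∈ I := by
  obtain ⟨n, hn⟩ := ha.exists_mul_star_mem hI
  have hself : ∀ k, (⟨a k, mem_MonM a k⟩ * star ⟨a k, mem_MonM a k⟩ : ↥(MonM a)) ∈ I →
      (⟨a k, mem_MonM a k⟩ : ↥(MonM a)) ∈ I := by
    intro k hk
    have := I.mul_mem_right _ ⟨a k, mem_MonM a k⟩ hk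
    rwa [show _ * _ = (⟨a k, mem_MonM a k⟩ : ↥(MonM a)) from
      Subtype.ext (ha.mul_star_mul_self k)] at this
  rcases lt_or_ge n k with hk | hk
  · have := I.mul_mem_left ⟨a k, mem_MonM a k⟩ _ hn
    rwa [show _ * _ = (⟨a k, mem_MonM a k⟩ : ↥(MonM a)) from
      Subtype.ext (ha.mul_mul_star_of_lt hk)] at this
  · refine hself k ?_
    induction k, hk using Int.leInductionDown with
    | base => exact hn
    | pred m _ ih =>
      have h := I.add_mem ih (I.mul_mem_left (star ⟨a m, mem_MonM a m⟩) _ (hself m ih))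
      rwa [show _ + _ = (⟨a (m - 1), mem_MonM a (m - 1)⟩ * star ⟨a (m - 1), mem_MonM a (m - 1)⟩ :
        ↥(MonM a)) from Subtype.ext (ha.mul_star_pred m).symm] at h

theorem MonI_subset_ideal {I : TwoSidedIdeal ↥(MonM a)} (hI : I ≠ ⊥)
    (hcl : IsClosed (I : Set ↥(MonM a))) {x : ↥(MonM a)} (hx : (x : MF →L[ℂ] MF) ∈ MonI a) :
    x ∈ I := by
  have hJ : IsClosed (Subtype.val '' (I : Set ↥(MonM a))) :=
    (StarSubalgebra.isClosed_topologicalClosure _).isClosedEmbedding_subtypeVal.isClosedMap _ hcl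
  suffices h : (x : MF →L[ℂ] MF) ∈ Subtype.val '' (I : Set ↥(MonM a)) by
    obtain ⟨y, hy, hyx⟩ := h
    exact Subtype.ext hyx ▸ hy
  refine closure_minimal (fun z hz => ?_) hJ hx
  have hz' : z ∈ NonUnitalStarAlgebra.adjoin ℂ (Set.range a) := hz
  rw [← NonUnitalStarSubalgebra.mem_toNonUnitalSubalgebra,
    NonUnitalStarAlgebra.adjoin_toNonUnitalSubalgebra] at hz'
  clear hz
  induction hz' using NonUnitalAlgebra.adjoin_induction with
  | mem x hx =>
    rcases hx with ⟨i, rfl⟩ | ⟨i, hi⟩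
    · exact ⟨_, ha.generator_mem hI i, rfl⟩
    · obtain rfl : star (a i) = x := by rw [hi, star_star]
      refine ⟨star ⟨a i, mem_MonM a i⟩ * (⟨a i, mem_MonM a i⟩ * star ⟨a i, mem_MonM a i⟩),
        I.mul_mem_left _ _ (I.mul_mem_right _ _ (ha.generator_mem hI i)), ?_⟩
      have h := congrArg star (ha.mul_star_mul_self i)
      rwa [star_mul, star_mul, star_star] at h
  | zero => exact ⟨0, I.zero_mem, rfl⟩
  | add x y _ _ hx hy =>
    obtain ⟨x, hx, rfl⟩ := hx
    obtain ⟨y, hy, rfl⟩ := hy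
    exact ⟨x + y, I.add_mem hx hy, rfl⟩
  | mul x y _ _ hx hy =>
    obtain ⟨x, hx, rfl⟩ := hx
    obtain ⟨y, hy, rfl⟩ := hy
    exact ⟨x * y, I.mul_mem_left _ _ hy, rfl⟩
  | smul c x _ hx =>
    obtain ⟨x, hx, rfl⟩ := hx
    refine ⟨c • x, ?_, rfl⟩
    rw [← one_mul x, ← smul_mul_assoc]
    exact I.mul_mem_left _ _ hx

end IsMonotoneAnnihilation

/-- `𝔦` is a norm-closed two-sided ideal of `𝔐`, and every norm-closed two-sided ideal
of `𝔐` equals `{0}`, `𝔦` or `𝔐`. -/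
theorem stmt17 (a : ℤ → MF →L[ℂ] MF) (ha : IsMonotoneAnnihilation a) :
    IsClosed ((MonI a : Set (MF →L[ℂ] MF))) ∧
    (∀ x ∈ MonM a, ∀ y ∈ MonI a, x * y ∈ MonI a ∧ y * x ∈ MonI a) ∧
    (∀ I : TwoSidedIdeal ↥(MonM a), IsClosed (I : Set ↥(MonM a)) →
      I = ⊥ ∨ (∀ x : ↥(MonM a), x ∈ I ↔ (x : MF →L[ℂ] MF) ∈ MonI a) ∨ I = ⊤) := by
  refine ⟨NonUnitalStarSubalgebra.isClosed_topologicalClosure _, fun x hx y hy => ?_,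
    fun I hcl => ?_⟩
  · obtain ⟨z, hz, c, rfl⟩ := exists_MonI_add_algebraMap a hx
    rw [add_mul, mul_add, smul_mul_assoc, mul_smul_comm, one_mul, mul_one]
    exact ⟨add_mem (mul_mem hz hy) (SMulMemClass.smul_mem _ hy),
      add_mem (mul_mem hy hz) (SMulMemClass.smul_mem _ hy)⟩
  · by_cases hI : I = ⊥
    · exact Or.inl hI
    refine Or.inr ?_
    by_cases hsub : ∀ x ∈ I, (x : MF →L[ℂ] MF) ∈ MonI a
    · exact Or.inl fun x => ⟨hsub x, ha.MonI_subset_ideal hI hcl⟩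
    · push Not at hsub
      obtain ⟨x, hxI, hx⟩ := hsub
      obtain ⟨y, hy, c, hxy⟩ := exists_MonI_add_algebraMap a x.2
      have hc : c ≠ 0 := by
        rintro rfl
        rw [zero_smul, add_zero] at hxy
        exact hx (hxy ▸ hy)
      have hyI : (⟨y, MonI_subset_MonM a hy⟩ : ↥(MonM a)) ∈ I := ha.MonI_subset_ideal hI hcl hy
      have h1 := I.mul_mem_left (c⁻¹ • 1) _ (I.sub_mem hxI hyI)
      have e : (c⁻¹ • 1 : ↥(MonM a)) * (x - ⟨y, MonI_subset_MonM a hy⟩) = 1 := by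
        refine Subtype.ext ?_
        change (c⁻¹ • 1 : MF →L[ℂ] MF) * (x - y) = 1
        rw [hxy, add_sub_cancel_left, smul_mul_assoc, one_mul, smul_smul, inv_mul_cancel₀ hc,
          one_smul]
      rw [e] at h1
      exact Or.inr (I.one_mem_iff.1 h1)
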